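/- arXiv:2004.09075 — 6 statements merged into one kernel-verified Lean document; each statement's English description precedes it below -/
import Mathlib

section
/- Every housing market with strict preferences admits a core allocation, i.e., there exists an allocation x such that no coalition S of agents and allocation y satisfy {y_i : i ∈ S} = {ω_i : i ∈ S} and y_i ≻_i x_i for every i ∈ S. -/
open Finset

/-! ## Shapley–Scarf housing markets

There are `n` agents; agent `i` owns house `i` (houses are identified with their
owners).  Agent `i`'s strict linear preference over the `n` houses is encoded by
the bijection `pref i` sending each house to its position in `i`'s preference
list (position `0` = most preferred). -/

/-- Agent `i` strictly prefers house `h` to house `h'`. -/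
def Prefers {n : ℕ} (pref : Fin n → (Fin n ≃ Fin n)) (i h h' : Fin n) : Prop :=
  pref i h < pref i h'

instance {n : ℕ} (pref : Fin n → (Fin n ≃ Fin n)) (i h h' : Fin n) :
    Decidable (Prefers pref i h h') :=
  inferInstanceAs (Decidable (pref i h < pref i h'))

/-- The rank of house `h` for agent `i`: the number of houses weakly preferred
by `i` to `h` (the most preferred house has rank 1). -/
def rk {n : ℕ} (pref : Fin n → (Fin n ≃ Fin n)) (i h : Fin n) : ℕ :=
  (Finset.univ.filter fun h' => pref i h' ≤ pref i h).card

/-- `x` is an allocation of the submarket consisting of the agents in `S` (and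
their houses): it redistributes the houses of `S` among the members of `S`,
each agent receiving exactly one house. -/
def IsAllocOn {n : ℕ} (S : Finset (Fin n)) (x : Fin n → Fin n) : Prop :=
  Set.BijOn x ↑S ↑S

/-- `x` is a core allocation of the submarket consisting of the agents in `S`:
it is an allocation on `S` and no nonempty coalition `T ⊆ S` can redistribute
its own endowment `{ω_i : i ∈ T} = T` among itself so that every member of `T`
is strictly better off than under `x`. -/
def IsCoreOn {n : ℕ} (pref : Fin n → (Fin n ≃ Fin n)) (S : Finset (Fin n))
    (x : Fin n → Fin n) : Prop :=
  IsAllocOn S x ∧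
    ¬ ∃ (T : Finset (Fin n)) (y : Fin n → Fin n), T ⊆ S ∧ T.Nonempty ∧
        Set.BijOn y ↑T ↑T ∧ ∀ i ∈ T, Prefers pref i (y i) (x i)

/-- `x` is a core allocation of the whole housing market. -/
def IsCore {n : ℕ} (pref : Fin n → (Fin n ≃ Fin n)) (x : Fin n → Fin n) : Prop :=
  IsCoreOn pref Finset.univ x

/-- An extended housing market: `com` assigns each agent to one of `k`
communities; `community com j` is the set of agents of community `j`. -/
def community {n k : ℕ} (com : Fin n → Fin k) (j : Fin k) : Finset (Fin n) :=
  Finset.univ.filter fun i => com i = j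

/-- The `n`-th harmonic number, as a rational number. -/
def H (n : ℕ) : ℚ := ∑ i ∈ Finset.range n, (1 : ℚ) / (i + 1)

/-- A self-map of a nonempty finite set restricts to a bijection of some nonempty subset. -/
theorem exists_nonempty_bijOn_self {α : Type*} [DecidableEq α] {S : Finset α}
    (hS : S.Nonempty) {f : α → α} (hf : ∀ i ∈ S, f i ∈ S) :
    ∃ C ⊆ S, C.Nonempty ∧ Set.BijOn f ↑C ↑C := by
  induction S using Finset.strongInduction with
  | H S ih =>
    have hsub : S.image f ⊆ S := Finset.image_subset_iff.2 hf
    rcases hsub.eq_or_ssubset with heq | hlt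
    · refine ⟨S, subset_rfl, hS, hf, Finset.card_image_iff.1 (by rw [heq]), ?_⟩
      rw [Set.SurjOn, ← Finset.coe_image, heq]
    · obtain ⟨C, hC, hne, hbij⟩ := ih _ hlt (hS.image f)
        fun i hi => Finset.mem_image_of_mem f (hsub hi)
      exact ⟨C, hC.trans hsub, hne, hbij⟩

/-- If every agent of `C` receives their favourite house of `S` and the agents of `S \ C` receive a
core allocation of their own submarket, the result is a core allocation on `S`. -/
theorem IsCoreOn.piecewise {n : ℕ} {pref : Fin n → (Fin n ≃ Fin n)} {S C : Finset (Fin n)}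
    {f x : Fin n → Fin n} (hCS : C ⊆ S) (hC : Set.BijOn f ↑C ↑C)
    (hf : ∀ i ∈ C, ∀ h ∈ S, pref i (f i) ≤ pref i h) (hx : IsCoreOn pref (S \ C) x) :
    IsCoreOn pref S (C.piecewise f x) := by
  obtain ⟨halloc, hcore⟩ := hx
  refine ⟨?_, ?_⟩
  · have h₁ : Set.BijOn (C.piecewise f x) ↑C ↑C :=
      hC.congr fun i hi => (Finset.piecewise_eq_of_mem C f x hi).symm
    have h₂ : Set.BijOn (C.piecewise f x) ↑(S \ C) ↑(S \ C) :=
      halloc.congr fun i hi =>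
        (Finset.piecewise_eq_of_notMem C f x (Finset.mem_sdiff.1 hi).2).symm
    have hdisj : Disjoint (C : Set (Fin n)) ↑(S \ C) :=
      Finset.disjoint_coe.2 Finset.disjoint_sdiff
    have h := h₁.union h₂ ((Set.injOn_union hdisj).2 ⟨h₁.injOn, h₂.injOn, fun i hi j hj =>
      hdisj.ne_of_mem (h₁.mapsTo hi) (h₂.mapsTo hj)⟩)
    rwa [← Finset.coe_union, Finset.union_sdiff_of_subset hCS] at h
  · rintro ⟨T, y, hTS, hT, hy, hpref⟩
    have hTC : ∀ i ∈ T, i ∉ C := fun i hi hiC => by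
      have hlt := hpref i hi
      rw [Finset.piecewise_eq_of_mem C f x hiC] at hlt
      exact (hf i hiC (y i) (hTS (hy.mapsTo hi))).not_gt hlt
    refine hcore ⟨T, y, fun i hi => Finset.mem_sdiff.2 ⟨hTS hi, hTC i hi⟩, hT, hy, fun i hi => ?_⟩
    have hlt := hpref i hi
    rwa [Finset.piecewise_eq_of_notMem C f x (hTC i hi)] at hlt

/-- Every submarket admits a core allocation, by Gale's top trading cycles algorithm. -/
theorem exists_isCoreOn {n : ℕ} (pref : Fin n → (Fin n ≃ Fin n)) (S : Finset (Fin n)) :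
    ∃ x : Fin n → Fin n, IsCoreOn pref S x := by
  induction S using Finset.strongInduction with
  | H S ih =>
    rcases S.eq_empty_or_nonempty with rfl | hS
    · refine ⟨id, Set.bijOn_id _, ?_⟩
      rintro ⟨T, -, hT, hne, -⟩
      exact hne.ne_empty (Finset.subset_empty.1 hT)
    · choose f hfS hf using fun i => S.exists_min_image (pref i) hS
      obtain ⟨C, hCS, hne, hC⟩ := exists_nonempty_bijOn_self hS fun i _ => hfS i
      obtain ⟨x, hx⟩ := ih (S \ C) (Finset.sdiff_ssubset hCS hne)
      exact ⟨C.piecewise f x, hx.piecewise hCS hC fun i _ => hf i⟩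

/-- Every housing market with strict preferences admits a core
allocation. -/
theorem core_exists (n : ℕ) (pref : Fin n → (Fin n ≃ Fin n)) :
    ∃ x : Fin n → Fin n, IsCore pref x := by
  exact exists_isCoreOn pref Finset.univ
end

section
/- In any core allocation x of a housing market with n agents, for every integer r with 1 ≤ r ≤ n, the number of agents i with rk_i(x_i) = r is at most n − r + 1. -/
open Finset

/-- A self-map of a finite type whose values lie in `S` has a nonempty set of periodic points,
contained in `S`, which it permutes. -/
lemma exists_bijOn_subset_of_mem {α : Type*} [Finite α] [Nonempty α] {S : Finset α} (f : α → α)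
    (hf : ∀ a, f a ∈ S) :
    ∃ T : Finset α, T ⊆ S ∧ T.Nonempty ∧ Set.BijOn f ↑T ↑T := by
  have hfin : (Function.periodicPts f).Finite := Set.toFinite _
  refine ⟨hfin.toFinset, fun a ha => ?_, ?_, ?_⟩
  · rw [Set.Finite.mem_toFinset] at ha
    obtain ⟨b, -, rfl⟩ := (Function.bijOn_periodicPts f).surjOn ha
    exact hf b
  · rw [Set.Finite.toFinset_nonempty]
    obtain ⟨a⟩ := ‹Nonempty α›
    obtain ⟨k, l, hkl, h⟩ :=
      Set.finite_univ.exists_lt_map_eq_of_forall_mem (f := fun k : ℕ => f^[k] a)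
        fun k => Set.mem_univ _
    refine ⟨f^[k] a, l - k, Nat.sub_pos_of_lt hkl, ?_⟩
    rw [Function.IsPeriodicPt, Function.IsFixedPt, ← Function.iterate_add_apply,
      Nat.sub_add_cancel hkl.le]
    exact h.symm
  · rw [Set.Finite.coe_toFinset]
    exact Function.bijOn_periodicPts f

/-- Under a core allocation, every nonempty set `S` of agents has a member who envies nobody
in `S`. -/
lemma IsCore.exists_forall_not_prefers {n : ℕ} {pref : Fin n → (Fin n ≃ Fin n)}
    {x : Fin n → Fin n} (hx : IsCore pref x) {S : Finset (Fin n)} (hS : S.Nonempty) :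
    ∃ i ∈ S, ∀ h ∈ S, ¬ Prefers pref i h (x i) := by
  by_contra! hcon
  obtain ⟨s, hs⟩ := hS
  have : ∀ i, ∃ h ∈ S, i ∈ S → Prefers pref i h (x i) := fun i => by
    by_cases hi : i ∈ S
    · obtain ⟨h, hh, hp⟩ := hcon i hi
      exact ⟨h, hh, fun _ => hp⟩
    · exact ⟨s, hs, fun h => absurd h hi⟩
  choose f hfS hf using this
  have : Nonempty (Fin n) := ⟨s⟩
  obtain ⟨T, hTS, hT, hbij⟩ := exists_bijOn_subset_of_mem f hfS
  exact hx.2 ⟨T, f, T.subset_univ, hT, hbij, fun i hi => hf i (hTS hi)⟩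

/-- In any core allocation `x` of a housing market with `n`
agents, for every `1 ≤ r ≤ n`, the number of agents `i` with `rk_i(x_i) = r`
is at most `n - r + 1`. -/
theorem core_rank_eq_count_bound (n : ℕ) (pref : Fin n → (Fin n ≃ Fin n))
    (x : Fin n → Fin n) (hx : IsCore pref x) (r : ℕ) (hr1 : 1 ≤ r) (hr2 : r ≤ n) :
    (Finset.univ.filter fun i => rk pref i (x i) = r).card ≤ n - r + 1 := by
  set S := Finset.univ.filter fun i => rk pref i (x i) = r with hSdef
  obtain hS | hS := S.eq_empty_or_nonempty
  · simp [hS]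
  obtain ⟨i, hi, hmax⟩ := hx.exists_forall_not_prefers hS
  have hri : rk pref i (x i) = r := (Finset.mem_filter.mp hi).2
  have hsub : (Finset.univ.filter fun h => pref i h ≤ pref i (x i)) ⊆ insert (x i) Sᶜ := by
    intro h hh
    rw [Finset.mem_insert, Finset.mem_compl]
    obtain heq | hlt := (Finset.mem_filter.mp hh).2.eq_or_lt
    · exact Or.inl ((pref i).injective heq)
    · exact Or.inr fun hhS => hmax h hhS hlt
  have hcard : r ≤ Sᶜ.card + 1 :=
    hri ▸ (Finset.card_le_card hsub).trans (Finset.card_insert_le _ _)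
  have hcompl : S.card + Sᶜ.card = n := by
    rw [Finset.card_add_card_compl, Fintype.card_fin]
  omega
end

section
/- In any extended housing market, every community C_j contains at least one agent who is not harmed by integration, i.e., at least one agent i ∈ C_j weakly prefers her integrated core house to her segregated core house. -/
open Finset

/-- In any extended housing market, every community contains at
least one agent who is not harmed by integration, i.e. who weakly prefers her
integrated core house to her segregated core house. -/
theorem exists_unharmed_in_community (n k : ℕ) (pref : Fin n → (Fin n ≃ Fin n))
    (com : Fin n → Fin k) (hcom : Function.Surjective com)
    (xseg xint : Fin n → Fin n)
    (hseg : ∀ j : Fin k, IsCoreOn pref (community com j) xseg)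
    (hint : IsCore pref xint) (j : Fin k) :
    ∃ i ∈ community com j, ¬ Prefers pref i (xseg i) (xint i) := by
  by_contra! h
  obtain ⟨i, hi⟩ := hcom j
  exact hint.2 ⟨community com j, xseg, Finset.subset_univ _, ⟨i, by simp [community, hi]⟩,
    (hseg j).1, h⟩
end

section
/- In any extended housing market with n agents partitioned into k communities, the number of agents harmed by integration under the core matching scheme is at most n − k, i.e., |N^-(σ*)| ≤ n − k. -/
open Finset

/-- In any extended housing market with `n` agents partitioned
into `k` (nonempty) communities, the number of agents harmed by integration
under the core matching scheme is at most `n - k`. -/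
theorem harmed_card_le (n k : ℕ) (pref : Fin n → (Fin n ≃ Fin n))
    (com : Fin n → Fin k) (hcom : Function.Surjective com)
    (xseg xint : Fin n → Fin n)
    (hseg : ∀ j : Fin k, IsCoreOn pref (community com j) xseg)
    (hint : IsCore pref xint) :
    (Finset.univ.filter fun i => Prefers pref i (xseg i) (xint i)).card ≤ n - k := by
  have hex : ∀ j, ∃ i, com i = j ∧ ¬ Prefers pref i (xseg i) (xint i) := by
    intro j
    by_contra! hj
    obtain ⟨i, hi⟩ := hcom j
    refine hint.2 ⟨community com j, xseg, subset_univ _, ⟨i, by simp [community, hi]⟩,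
      (hseg j).1, fun m hm => hj m ?_⟩
    simpa [community] using hm
  choose f hf hfn using hex
  have hk : k ≤ (univ.filter fun i => ¬ Prefers pref i (xseg i) (xint i)).card := by
    have hcard := card_le_card_of_injOn (s := (univ : Finset (Fin k)))
      (t := univ.filter fun i => ¬ Prefers pref i (xseg i) (xint i)) f
      (fun j _ => by simp [hfn j]) (Function.LeftInverse.injective hf).injOn
    simpa using hcard
  have hsum := card_filter_add_card_filter_not (s := (univ : Finset (Fin n)))
    (fun i => Prefers pref i (xseg i) (xint i))
  rw [card_univ, Fintype.card_fin] at hsum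
  omega
end

section
/- The function f(m) = ((m+1)H_m − m)/(m(m+1)) is strictly decreasing on the positive integers; consequently, in a random extended housing market the expected percentile gains from integration, (n+1)[(m+1)H_m − m]/(m(m+1)n) − ((n+1)H_n − n)/n², are strictly larger for agents in smaller communities: if 1 ≤ m < m' ≤ n then the expected gains of a community of size m exceed those of a community of size m'. -/
open Finset

/-- The function `f(m) = ((m+1)H_m - m)/(m(m+1))`. -/
def f (m : ℕ) : ℚ := (((m : ℚ) + 1) * H m - m) / ((m : ℚ) * ((m : ℚ) + 1))

/-- The expected average percentile gains from integration of a community of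
size `m` in a random extended housing market of total size `n`. -/
def expGains (n m : ℕ) : ℚ :=
  ((n : ℚ) + 1) * (((m : ℚ) + 1) * H m - m) / ((m : ℚ) * ((m : ℚ) + 1) * n) -
    (((n : ℚ) + 1) * H n - n) / (n : ℚ) ^ 2

theorem H_succ (m : ℕ) : H (m + 1) = H m + 1 / ((m : ℚ) + 1) := by
  simp [H, Finset.sum_range_succ]

theorem lt_H {m : ℕ} (hm : 1 ≤ m) :
    (m : ℚ) / (m + 1) + (m : ℚ) / (m + 2) < H m := by
  induction m, hm using Nat.le_induction with
  | base => norm_num [H]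
  | succ m hm ih =>
    rw [H_succ]
    refine lt_of_le_of_lt ?_ (add_lt_add_left ih _)
    have key : (m : ℚ) / (m + 1) + m / (m + 2) + 1 / (m + 1) -
        ((m + 1) / (m + 1 + 1) + (m + 1) / (m + 1 + 2)) = (m + 1) / ((m + 2) * (m + 3)) := by
      field_simp
      ring
    have : (0 : ℚ) ≤ (m + 1) / ((m + 2) * (m + 3)) := by positivity
    push_cast
    linarith

theorem f_succ_lt {m : ℕ} (hm : 1 ≤ m) : f (m + 1) < f m := by
  have hm' : (0 : ℚ) < m := by exact_mod_cast hm
  have key : f m - f (m + 1) =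
      (H m - ((m : ℚ) / (m + 1) + (m : ℚ) / (m + 2))) / (m * (m + 1)) := by
    simp only [f, H_succ]
    push_cast
    field_simp
    ring
  have : 0 < f m - f (m + 1) := by
    rw [key]
    exact div_pos (sub_pos.2 (lt_H hm)) (by positivity)
  linarith

theorem f_lt_of_lt {m m' : ℕ} (hm : 1 ≤ m) (h : m < m') : f m' < f m := by
  induction m', h using Nat.le_induction with
  | base => exact f_succ_lt hm
  | succ k hk ih => exact (f_succ_lt (by omega)).trans ih

theorem expGains_eq (n m : ℕ) :
    expGains n m = ((n : ℚ) + 1) / n * f m - (((n : ℚ) + 1) * H n - n) / (n : ℚ) ^ 2 := by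
  rw [expGains, f, div_mul_div_comm, mul_comm (n : ℚ) ((m : ℚ) * _)]

/-- The function `f(m) = ((m+1)H_m - m)/(m(m+1))` is strictly
decreasing on the positive integers; consequently, in a random extended housing
market the expected percentile gains from integration are strictly larger for
agents in smaller communities: if `1 ≤ m < m' ≤ n`, the expected gains of a
community of size `m` exceed those of a community of size `m'`. -/
theorem f_strictAnti_and_smaller_communities_gain_more :
    (∀ m m' : ℕ, 1 ≤ m → m < m' → f m' < f m) ∧
      ∀ n m m' : ℕ, 1 ≤ m → m < m' → m' ≤ n → expGains n m' < expGains n m := by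
  refine ⟨fun m m' hm h => f_lt_of_lt hm h, fun n m m' hm h hn => ?_⟩
  have hn' : (0 : ℚ) < n := by exact_mod_cast (by omega : 0 < n)
  rw [expGains_eq, expGains_eq]
  gcongr
  exact f_lt_of_lt hm h
end

section
/- In any extended housing market, for each community C_j of size n_j, let t_j be the number of cycles (orbits, including fixed points) of the permutation of C_j induced by the segregated core allocation (where agent i is mapped to the owner of the house i receives). Then the number of agents in C_j harmed by integration satisfies |N^-_{C_j}(σ*)| ≤ n_j − t_j. -/
open Finset

/-- A permutation restricts to a bijection of each of its cycles. -/
theorem Equiv.Perm.bijOn_setOf_sameCycle {α : Type*} (σ : Equiv.Perm α) (i : α) :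
    Set.BijOn σ {l | σ.SameCycle i l} {l | σ.SameCycle i l} :=
  σ.bijOn fun _ => Equiv.Perm.sameCycle_apply_right

/-- A set mapped into itself by a permutation of a finite type contains the cycle of each of
its elements. -/
theorem Equiv.Perm.SameCycle.mem_of_mapsTo {α : Type*} [Finite α] {σ : Equiv.Perm α}
    {s : Set α} (hs : Set.MapsTo σ s s) {i l : α} (h : σ.SameCycle i l) (hi : i ∈ s) :
    l ∈ s := by
  obtain ⟨m, rfl⟩ := h.exists_nat_pow_eq
  rw [← Equiv.Perm.iterate_eq_pow]
  exact hs.iterate m hi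

/-- No coalition permuting its houses by `σ` along a cycle of `σ` blocks a core allocation. -/
theorem IsCore.exists_sameCycle_not_prefers {n : ℕ} {pref : Fin n → (Fin n ≃ Fin n)}
    {x : Fin n → Fin n} (hx : IsCore pref x) (σ : Equiv.Perm (Fin n)) (i : Fin n) :
    ∃ l, σ.SameCycle i l ∧ ¬ Prefers pref l (σ l) (x l) := by
  classical
  by_contra! h
  refine hx.2 ⟨univ.filter (σ.SameCycle i), σ, subset_univ _, ⟨i, by simp [Equiv.Perm.SameCycle.refl]⟩, ?_, ?_⟩
  · simpa using σ.bijOn_setOf_sameCycle i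
  · simpa using h

/-- In any extended housing market, for each community `C_j`
of size `n_j`, if `t_j` is the number of cycles (orbits, including fixed
points) on `C_j` of the permutation induced by the segregated core allocation
(agent `i` is mapped to the owner of the house she receives, i.e. to `xseg i`),
then the number of agents of `C_j` harmed by integration is at most
`n_j - t_j`. -/
theorem harmed_in_community_le_card_sub_cycles (n k : ℕ)
    (pref : Fin n → (Fin n ≃ Fin n)) (com : Fin n → Fin k)
    (hcom : Function.Surjective com) (xseg : Equiv.Perm (Fin n))
    (hseg : ∀ j : Fin k, IsCoreOn pref (community com j) xseg)
    (xint : Fin n → Fin n) (hint : IsCore pref xint) (j : Fin k) :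
    ((community com j).filter fun i => Prefers pref i (xseg i) (xint i)).card ≤
      (community com j).card -
        Set.ncard ((fun i => {l | xseg.SameCycle i l}) '' (community com j : Set (Fin n))) := by
  set cycle : Fin n → Set (Fin n) := fun i => {l | xseg.SameCycle i l}
  set unharmed := (community com j).filter fun i => ¬ Prefers pref i (xseg i) (xint i)
  have hsub : cycle '' (community com j : Set (Fin n)) ⊆ cycle '' (unharmed : Set (Fin n)) := by
    rintro _ ⟨i, hi, rfl⟩
    obtain ⟨l, hil, hl⟩ := hint.exists_sameCycle_not_prefers xseg i
    refine ⟨l, mem_coe.2 (mem_filter.2 ⟨?_, hl⟩), ?_⟩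
    · exact mem_coe.1 (hil.mem_of_mapsTo (hseg j).1.mapsTo hi)
    · exact Set.ext fun m => ⟨hil.trans, hil.symm.trans⟩
  have hle : (cycle '' (community com j : Set (Fin n))).ncard ≤ unharmed.card :=
    calc _ ≤ (cycle '' (unharmed : Set (Fin n))).ncard :=
          Set.ncard_le_ncard hsub (Set.toFinite _)
      _ ≤ (unharmed : Set (Fin n)).ncard := Set.ncard_image_le (Set.toFinite _)
      _ = unharmed.card := Set.ncard_coe_finset _
  have hsplit : ((community com j).filter fun i => Prefers pref i (xseg i) (xint i)).card +
      unharmed.card = (community com j).card :=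
    card_filter_add_card_filter_not _
  omega
end
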